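/- In the 1×w multi-Banana, the hexagon relations force a single C class and a single B class: in the free abelian group on A₀,...,A_{w-1}, B₀,...,B_{w-1}, C₀,...,C_{2w-1} modulo the hexagon relations of a 1×w cyclic chain of hexagons, all B classes are equal and all C classes are equal, so the quotient group is free of rank w+2. -/

import Mathlib

namespace OneByW

variable (w : ℕ)

/-- Generators of the free abelian group on the curves of the 1×w multi-Banana:
`A i` (vertical), `B i` (horizontal), and the two diagonal edges `C i`, `C' i` of the
`i`-th hexagon, for `i ∈ ℤ/w`. -/
def A (i : ZMod w) : FreeAbelianGroup (Fin 4 × ZMod w) := FreeAbelianGroup.of (0, i)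
def B (i : ZMod w) : FreeAbelianGroup (Fin 4 × ZMod w) := FreeAbelianGroup.of (1, i)
def C (i : ZMod w) : FreeAbelianGroup (Fin 4 × ZMod w) := FreeAbelianGroup.of (2, i)
def C' (i : ZMod w) : FreeAbelianGroup (Fin 4 × ZMod w) := FreeAbelianGroup.of (3, i)

/-- The hexagon relations of the 1×w cyclic chain of hexagons: for each hexagon `i`,
the two ruling relations `A i + C i = A i + C' i` (both vertical edges of hexagon `i`
have class `A i` in the 1-wide chain) and `B i + C i = B (i+1) + C' i`, together with
the diagonal gluing `C' i = C (i+1)`. -/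
def hexRels : Set (FreeAbelianGroup (Fin 4 × ZMod w)) :=
  (Set.range fun i : ZMod w => A w i + C w i - (A w i + C' w i)) ∪
  (Set.range fun i : ZMod w => B w i + C w i - (B w (i + 1) + C' w i)) ∪
  (Set.range fun i : ZMod w => C' w i - C w (i + 1))

variable {w} in
theorem eq_of_forall_add_one_eq [NeZero w] {α : Type*} {f : ZMod w → α}
    (hf : ∀ i, f (i + 1) = f i) (i j : ZMod w) : f i = f j := by
  have h (n : ℕ) : f n = f 0 := by
    induction n with
    | zero => simp
    | succ n ih => rw [Nat.cast_succ, hf, ih]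
  rw [← ZMod.natCast_zmod_val i, ← ZMod.natCast_zmod_val j, h, h]

/-- The class group of the chain: the free abelian group on generators modulo the hexagon
relations. -/
abbrev ClassGroup : Type :=
  FreeAbelianGroup (Fin 4 × ZMod w) ⧸ AddSubgroup.closure (hexRels w)

/-- The projection from the free abelian group on the curves to the class group. -/
abbrev toClass : FreeAbelianGroup (Fin 4 × ZMod w) →+ ClassGroup w :=
  QuotientAddGroup.mk' (AddSubgroup.closure (hexRels w))

variable {w} in
theorem toClass_eq_of_sub_mem {x y : FreeAbelianGroup (Fin 4 × ZMod w)}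
    (h : x - y ∈ hexRels w) : toClass w x = toClass w y := by
  rw [← sub_eq_zero, ← map_sub]
  exact (QuotientAddGroup.eq_zero_iff _).2 (AddSubgroup.subset_closure h)

theorem toClass_C'_eq (i : ZMod w) : toClass w (C' w i) = toClass w (C w i) := by
  have h := toClass_eq_of_sub_mem (w := w) (Or.inl (Or.inl ⟨i, rfl⟩))
  rw [map_add, map_add] at h
  exact (add_left_cancel h).symm

theorem toClass_C_add_one (i : ZMod w) : toClass w (C w (i + 1)) = toClass w (C w i) :=
  (toClass_eq_of_sub_mem (Or.inr ⟨i, rfl⟩)).symm.trans (toClass_C'_eq w i)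

theorem toClass_B_add_one (i : ZMod w) : toClass w (B w (i + 1)) = toClass w (B w i) := by
  have h := toClass_eq_of_sub_mem (w := w) (Or.inl (Or.inr ⟨i, rfl⟩))
  rw [map_add, map_add, toClass_C'_eq] at h
  exact (add_right_cancel h).symm

/-- The label of the class of a curve: each `A i` has its own class, all `B i` share the class
`Sum.inr 0`, and all diagonal curves share the class `Sum.inr 1`. -/
def label (p : Fin 4 × ZMod w) : ZMod w ⊕ Fin 2 :=
  ![Sum.inl p.2, Sum.inr 0, Sum.inr 1, Sum.inr 1] p.1

/-- The map from the class group to the free abelian group on labels. -/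
def classToFree : ClassGroup w →+ FreeAbelianGroup (ZMod w ⊕ Fin 2) :=
  QuotientAddGroup.lift _ (FreeAbelianGroup.map (label w)) <| by
    rw [AddSubgroup.closure_le]
    rintro _ ((⟨i, rfl⟩ | ⟨i, rfl⟩) | ⟨i, rfl⟩) <;> simp [A, B, C, C', label]

/-- The map from the free abelian group on labels to the class group, sending each label to the
class of a representative curve. -/
def freeToClass : FreeAbelianGroup (ZMod w ⊕ Fin 2) →+ ClassGroup w :=
  FreeAbelianGroup.lift <|
    Sum.elim (fun i => toClass w (A w i)) ![toClass w (B w 0), toClass w (C w 0)]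

theorem freeToClass_comp_classToFree [NeZero w] :
    (freeToClass w).comp (classToFree w) = AddMonoidHom.id _ := by
  refine QuotientAddGroup.addMonoidHom_ext _ (FreeAbelianGroup.lift_ext _ _ fun p => ?_)
  obtain ⟨k, i⟩ := p
  have hB := eq_of_forall_add_one_eq (f := fun i => toClass w (B w i)) (toClass_B_add_one w) 0 i
  have hC := eq_of_forall_add_one_eq (f := fun i => toClass w (C w i)) (toClass_C_add_one w) 0 i
  have hC' := hC.trans (toClass_C'_eq w i).symm
  fin_cases k
  · simp [classToFree, freeToClass, label, A]
  · simpa [classToFree, freeToClass, label, B] using hB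
  · simpa [classToFree, freeToClass, label, C] using hC
  · simpa [classToFree, freeToClass, label, C, C'] using hC'

theorem classToFree_comp_freeToClass :
    (classToFree w).comp (freeToClass w) = AddMonoidHom.id _ := by
  refine FreeAbelianGroup.lift_ext _ _ fun p => ?_
  rcases p with i | k
  · simp [classToFree, freeToClass, label, A]
  · fin_cases k <;> simp [classToFree, freeToClass, label, B, C]

/-- The class group is free abelian on the labels. -/
def classEquivFree [NeZero w] : ClassGroup w ≃+ FreeAbelianGroup (ZMod w ⊕ Fin 2) :=
  (classToFree w).toAddEquiv (freeToClass w) (freeToClass_comp_classToFree w)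
    (classToFree_comp_freeToClass w)

/-- In the quotient of the free abelian group on `A_i, B_i, C_i, C'_i` (`i ∈ ℤ/w`) by
the 1×w hexagon relations, all `B` classes coincide and all diagonal classes `C_i, C'_i`
coincide, and the quotient is free abelian of rank `w + 2`. -/
theorem curve_class_group (hw : 0 < w) :
    let π := QuotientAddGroup.mk' (AddSubgroup.closure (hexRels w))
    (∀ i j : ZMod w, π (B w i) = π (B w j)) ∧
    (∀ i j : ZMod w, π (C w i) = π (C w j)) ∧
    (∀ i j : ZMod w, π (C' w i) = π (C w j)) ∧
    Nonempty
      ((FreeAbelianGroup (Fin 4 × ZMod w) ⧸ AddSubgroup.closure (hexRels w)) ≃+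
        (Fin (w + 2) → ℤ)) := by
  have : NeZero w := ⟨hw.ne'⟩
  intro π
  have hC := eq_of_forall_add_one_eq (f := fun i => toClass w (C w i)) (toClass_C_add_one w)
  refine ⟨eq_of_forall_add_one_eq (toClass_B_add_one w), hC,
    fun i j => (toClass_C'_eq w i).trans (hC i j), ?_⟩
  have e : ZMod w ⊕ Fin 2 ≃ Fin (w + 2) :=
    Fintype.equivFinOfCardEq (by simp [ZMod.card])
  exact ⟨(classEquivFree w).trans <| (FreeAbelianGroup.equivOfEquiv e).trans <|
    (FreeAbelianGroup.equivFinsupp _).trans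
      (Finsupp.linearEquivFunOnFinite ℤ ℤ (Fin (w + 2))).toAddEquiv⟩

end OneByW
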